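/- arXiv:1305.1262 — 2 statements merged into one kernel-verified Lean document; each statement's English description precedes it below -/
import Mathlib

section
/- (Proposition 2, partial measurement rule.) Let A₁ be a nonempty set of vectors in EuclideanSpace ℂ (Fin m), A₂ a nonempty set of vectors in EuclideanSpace ℂ (Fin n), and ψ : EuclideanSpace ℂ (Fin m × Fin n). Suppose that for all χ₁ ∈ A₁ and χ₂ ∈ A₂ one has ⟪ψ, χ₁ ⊗ χ₂⟫ ≠ 0, and suppose φ₁ ∈ A₁. Then for every χ₂ ∈ A₂, ⟪appl₁(φ₁, ψ), χ₂⟫ ≠ 0. -/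
open scoped InnerProductSpace

/-- Tensor product of vectors in Euclidean spaces:
`(f ⊗ g)(i, j) = f i * g j`. -/
noncomputable def tp {m n : ℕ} (f : EuclideanSpace ℂ (Fin m)) (g : EuclideanSpace ℂ (Fin n)) :
    EuclideanSpace ℂ (Fin m × Fin n) :=
  WithLp.toLp 2 fun p => f p.1 * g p.2

/-- Partial application of `ψ` at place 1:
`appl₁(φ, ψ)(j) = ∑ i, ψ (i, j) * conj (φ i)`. -/
noncomputable def appl1 {m n : ℕ} (φ : EuclideanSpace ℂ (Fin m))
    (ψ : EuclideanSpace ℂ (Fin m × Fin n)) : EuclideanSpace ℂ (Fin n) :=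
  WithLp.toLp 2 fun j => ∑ i, ψ (i, j) * (starRingEnd ℂ) (φ i)

/-- Proposition 2 (partial measurement rule): if the composite system verifies `ψ`
(every joint outcome `χ₁ ⊗ χ₂` with `χ₁ ∈ A₁`, `χ₂ ∈ A₂` has nonzero inner product
with `ψ`) and outcome `φ₁ ∈ A₁` is obtained on the first subsystem, then the second
subsystem verifies `appl₁(φ₁, ψ)`. -/
theorem partial_measurement {m n : ℕ} (A₁ : Set (EuclideanSpace ℂ (Fin m)))
    (A₂ : Set (EuclideanSpace ℂ (Fin n))) (hA₁ : A₁.Nonempty) (hA₂ : A₂.Nonempty)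
    (ψ : EuclideanSpace ℂ (Fin m × Fin n))
    (hψ : ∀ χ₁ ∈ A₁, ∀ χ₂ ∈ A₂, ⟪ψ, tp χ₁ χ₂⟫_ℂ ≠ 0)
    (φ₁ : EuclideanSpace ℂ (Fin m)) (hφ₁ : φ₁ ∈ A₁) :
    ∀ χ₂ ∈ A₂, ⟪appl1 φ₁ ψ, χ₂⟫_ℂ ≠ 0 := by
  intro χ₂ hχ₂
  have key : ⟪appl1 φ₁ ψ, χ₂⟫_ℂ = ⟪ψ, tp φ₁ χ₂⟫_ℂ := by
    simp only [PiLp.inner_apply, RCLike.inner_apply, appl1, tp, map_sum, map_mul,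
      Complex.conj_conj, Fintype.sum_prod_type, Finset.mul_sum]
    rw [Finset.sum_comm]
    refine Finset.sum_congr rfl fun i _ => Finset.sum_congr rfl fun j _ => ?_
    ring
  rw [key]
  exact hψ φ₁ hφ₁ χ₂ hχ₂
end

section
/- (Generalized teleportation with an entangled spectator system.) Let d : ℕ and w : EuclideanSpace ℂ (Fin 2 × Fin d) be arbitrary (the joint state of wires C and D). Define Ψ₀ : EuclideanSpace ℂ (Fin 2 × Fin 2 × Fin 2 × Fin d) (slots ordered A, B, C, D) by Ψ₀(a,b,c,k) = (1/√2)·(if a = b then 1 else 0)·w(c,k). Let CNOT send the basis vector indexed (a,b,c,k) to the one indexed (a + c mod 2, b, c, k), and let H_C act as the Hadamard matrix (1/√2)·[[1,1],[1,−1]] on slot C and as the identity elsewhere; set Ψ = H_C (CNOT Ψ₀). For x, z ∈ Fin 2 define v_{x,z} : EuclideanSpace ℂ (Fin 2 × Fin d) by v_{x,z}(b,k) = Ψ(x,b,z,k). Then for all x, z, applying the Pauli correction Z^z X^x to the first factor of v_{x,z} (with X = [[0,1],[1,0]], Z = [[1,0],[0,−1]] acting on the index b, identity on the index k) yields (1/2)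 • w. -/
/-- Controlled-not with control on wire `C` and target on wire `A` (identity on the
spectator system `D`): it sends the basis vector indexed `(a, b, c, k)` to the one
indexed `(a + c, b, c, k)`; on states, `(CNOT ψ)(a, b, c, k) = ψ (a + c, b, c, k)`
since the map is an involution on basis indices. -/
noncomputable def CNOT (d : ℕ) :
    EuclideanSpace ℂ (Fin 2 × Fin 2 × Fin 2 × Fin d) →ₗ[ℂ]
      EuclideanSpace ℂ (Fin 2 × Fin 2 × Fin 2 × Fin d) where
  toFun ψ := WithLp.toLp 2 fun p => ψ (p.1 + p.2.2.1, p.2.1, p.2.2.1, p.2.2.2)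
  map_add' _ _ := rfl
  map_smul' _ _ := rfl

/-- The Hadamard gate on wire `C`, identity on wires `A`, `B` and on the spectator
system `D`, given by the matrix `(1/√2)·[[1,1],[1,−1]]` acting on the third slot. -/
noncomputable def H_C (d : ℕ) :
    EuclideanSpace ℂ (Fin 2 × Fin 2 × Fin 2 × Fin d) →ₗ[ℂ]
      EuclideanSpace ℂ (Fin 2 × Fin 2 × Fin 2 × Fin d) where
  toFun ψ := WithLp.toLp 2 fun p => ∑ c' : Fin 2,
    ((1 / Real.sqrt 2 : ℝ) : ℂ) * (!![1, 1; 1, -1] : Matrix (Fin 2) (Fin 2) ℂ) p.2.2.1 c' *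
      ψ (p.1, p.2.1, c', p.2.2.2)
  map_add' ψ ψ' := by
    ext p
    simp only [PiLp.add_apply, mul_add, Finset.sum_add_distrib]
  map_smul' a ψ := by
    ext p
    simp only [PiLp.smul_apply, smul_eq_mul, Finset.mul_sum, RingHom.id_apply]
    congr 1
    funext c'
    ring

/-- The Pauli `X` matrix. -/
noncomputable def pauliX : Matrix (Fin 2) (Fin 2) ℂ := !![0, 1; 1, 0]

/-- The Pauli `Z` matrix. -/
noncomputable def pauliZ : Matrix (Fin 2) (Fin 2) ℂ := !![1, 0; 0, -1]

/-- A `2 × 2` matrix acting on the first factor of `EuclideanSpace ℂ (Fin 2 × Fin d)`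
(identity on the second, `d`-dimensional, factor). -/
noncomputable def applyMat1 {d : ℕ} (M : Matrix (Fin 2) (Fin 2) ℂ)
    (v : EuclideanSpace ℂ (Fin 2 × Fin d)) : EuclideanSpace ℂ (Fin 2 × Fin d) :=
  WithLp.toLp 2 fun p => ∑ b' : Fin 2, M p.1 b' * v (b', p.2)

/-- Generalized teleportation with an entangled spectator system `D`: starting from
`Ψ₀(a,b,c,k) = (1/√2)·δ_{ab}·w(c,k)`, applying the CNOT and the Hadamard on `C`,
and then partially applying at outcomes `x` on wire `A` and `z` on wire `C`, the
Pauli correction `Z^z X^x` on the remaining qubit wire `B` yields `(1/2) • w`. -/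
theorem generalized_teleportation (d : ℕ) (w : EuclideanSpace ℂ (Fin 2 × Fin d))
    (Ψ₀ : EuclideanSpace ℂ (Fin 2 × Fin 2 × Fin 2 × Fin d))
    (hΨ₀ : Ψ₀ = WithLp.toLp 2 fun p : Fin 2 × Fin 2 × Fin 2 × Fin d => ((1 / Real.sqrt 2 : ℝ) : ℂ) *
      (if p.1 = p.2.1 then 1 else 0) * w (p.2.2.1, p.2.2.2))
    (Ψ : EuclideanSpace ℂ (Fin 2 × Fin 2 × Fin 2 × Fin d))
    (hΨ : Ψ = H_C d (CNOT d Ψ₀))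
    (v : Fin 2 → Fin 2 → EuclideanSpace ℂ (Fin 2 × Fin d))
    (hv : ∀ x z : Fin 2, v x z = WithLp.toLp 2 fun p : Fin 2 × Fin d => Ψ (x, p.1, z, p.2)) :
    ∀ x z : Fin 2,
      applyMat1 (pauliZ ^ (z : ℕ)) (applyMat1 (pauliX ^ (x : ℕ)) (v x z)) =
        (1 / 2 : ℂ) • w := by
  have hs : ((1 / Real.sqrt 2 : ℝ) : ℂ) * ((1 / Real.sqrt 2 : ℝ) : ℂ) = 1 / 2 := by
    rw [← Complex.ofReal_mul, div_mul_div_comm, Real.mul_self_sqrt (by norm_num)]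
    norm_num
  have h11 : (1 : Fin 2) + 1 = 0 := rfl
  intro x z
  rw [hv, hΨ, hΨ₀]
  rw [one_div, Complex.ofReal_inv] at hs
  ext ⟨b, k⟩
  fin_cases x <;> fin_cases z <;> fin_cases b <;>
    simp [applyMat1, H_C, CNOT, pauliX, pauliZ, Fin.sum_univ_two, Matrix.one_apply, h11] <;>
    linear_combination (w (_, k)) * hs
end
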